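/- Let (Ω, f) be a topologically transitive finitely presented (FP) system with Ω nonempty. Then each set P_n(f) = {x ∈ Ω : f^n(x) = x} is finite and the topological entropy equals the exponential growth rate of periodic points: h(f) = limsup_{n→∞} (1/n) log p_n(f), where p_n(f) = |P_n(f)|. -/

import Mathlib

/-- The shift map on the full shift `A^ℤ`: `(σ x) i = x (i+1)`. -/
def shiftMap {A : Type*} : (ℤ → A) → (ℤ → A) := fun x i => x (i + 1)

/-- A one-step shift of finite type: the set of bi-infinite sequences all of whose
adjacent pairs lie in a relation `R ⊆ A × A`. -/
def IsOneStepSFT {A : Type*} (X : Set (ℤ → A)) : Prop :=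
  ∃ R : Set (A × A), X = {x | ∀ i : ℤ, (x i, x (i + 1)) ∈ R}

/-- Topological transitivity of a map `f` on a topological space. -/
def TopTrans {Ω : Type*} [TopologicalSpace Ω] (f : Ω → Ω) : Prop :=
  ∀ U V : Set Ω, IsOpen U → IsOpen V → U.Nonempty → V.Nonempty →
    ∃ n : ℕ, 0 < n ∧ (U ∩ f^[n] ⁻¹' V).Nonempty

/-- `E` is `(n, ε)`-separated for `f`. -/
def IsSeparatedSet {Ω : Type*} [PseudoMetricSpace Ω] (f : Ω → Ω) (n : ℕ) (ε : ℝ)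
    (E : Set Ω) : Prop :=
  ∀ x ∈ E, ∀ y ∈ E, x ≠ y → ∃ i, i < n ∧ ε < dist (f^[i] x) (f^[i] y)

/-- The maximal cardinality of an `(n, ε)`-separated set for `f`. -/
noncomputable def sepNum {Ω : Type*} [PseudoMetricSpace Ω] (f : Ω → Ω) (n : ℕ) (ε : ℝ) : ℕ :=
  sSup {k : ℕ | ∃ E : Finset Ω, IsSeparatedSet f n ε ↑E ∧ E.card = k}

/-- Bowen's topological entropy via separated sets:
`h(f) = lim_{ε → 0⁺} limsup_n (1/n) log s_n(ε)`; since the inner quantity is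
monotone in `ε`, the limit equals the supremum over `ε > 0`. -/
noncomputable def topEntropy {Ω : Type*} [PseudoMetricSpace Ω] (f : Ω → Ω) : EReal :=
  ⨆ (ε : ℝ) (_ : 0 < ε),
    Filter.atTop.limsup (fun n : ℕ => ((Real.log (sepNum f n ε) / n : ℝ) : EReal))

/-- An expansive homeomorphism: some `ε > 0` separates every pair of distinct points
under some (possibly negative) iterate. -/
def ExpansiveHomeo {Ω : Type*} [MetricSpace Ω] (f : Ω ≃ₜ Ω) : Prop :=
  ∃ ε : ℝ, 0 < ε ∧ ∀ x y : Ω, x ≠ y →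
    ∃ n : ℤ, ε < dist ((f.toEquiv ^ n) x) ((f.toEquiv ^ n) y)

/-- A finitely presented (FP) system: an expansive homeomorphism of a compact metric
space which is a factor of some one-step SFT over some finite alphabet. -/
def IsFPSystem {Ω : Type*} [MetricSpace Ω] [CompactSpace Ω] (f : Ω ≃ₜ Ω) : Prop :=
  ExpansiveHomeo f ∧
    ∃ (m : ℕ) (X : Set (ℤ → Fin m)) (π : (ℤ → Fin m) → Ω),
      IsOneStepSFT X ∧ ContinuousOn π X ∧ π '' X = Set.univ ∧
        ∀ x ∈ X, π (shiftMap x) = f (π x)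

open Filter Topology

theorem limsup_log_div_le_of_le_sum {u p : ℕ → ℕ} {M L : ℕ}
    (h : ∀ n, u n ≤ ∑ l ∈ Finset.range (L + 1), p (n + M + l)) :
    atTop.limsup (fun n : ℕ => ((Real.log (u n) / n : ℝ) : EReal)) ≤
      atTop.limsup (fun n : ℕ => ((Real.log (p n) / n : ℝ) : EReal)) := by
  rw [← EReal.le_of_forall_lt_iff_le]
  intro c hc
  have hev : ∀ᶠ n : ℕ in atTop, Real.log (p n) / n < c := by
    filter_upwards [eventually_lt_of_limsup_lt hc] with n hn
    exact_mod_cast hn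
  obtain ⟨N, hN⟩ := eventually_atTop.1 hev
  have hc0 : 0 ≤ c :=
    (div_nonneg (Real.log_natCast_nonneg _) (Nat.cast_nonneg _)).trans (hN N le_rfl).le
  have hp : ∀ n, N ≤ n → 0 < n → (p n : ℝ) ≤ Real.exp (c * n) := by
    intro n hn hn0
    have h1 := hN n hn
    rw [div_lt_iff₀ (by exact_mod_cast hn0)] at h1
    rcases Nat.eq_zero_or_pos (p n) with h0 | h0
    · rw [h0]
      simpa using (Real.exp_pos _).le
    · exact (Real.log_le_iff_le_exp (by exact_mod_cast h0)).1 h1.le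
  set K : ℝ := Real.log (L + 1) + c * (M + L) with hK
  have hK0 : 0 ≤ K := by
    have : 0 ≤ Real.log ((L : ℝ) + 1) := Real.log_nonneg (by simp)
    positivity
  have hu : ∀ᶠ n : ℕ in atTop, Real.log (u n) / n ≤ K / n + c := by
    filter_upwards [eventually_ge_atTop N, eventually_gt_atTop 0] with n hn hn0
    have hn0' : (0 : ℝ) < n := by exact_mod_cast hn0
    have hle : (u n : ℝ) ≤ (L + 1) * Real.exp (c * (n + M + L)) := by
      calc (u n : ℝ) ≤ ∑ l ∈ Finset.range (L + 1), (p (n + M + l) : ℝ) := by exact_mod_cast h n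
        _ ≤ ∑ l ∈ Finset.range (L + 1), Real.exp (c * (n + M + L)) := by
          refine Finset.sum_le_sum fun l hl => (hp _ (by omega) (by omega)).trans ?_
          have : (l : ℝ) ≤ L := by exact_mod_cast Nat.lt_succ_iff.1 (Finset.mem_range.1 hl)
          push_cast
          gcongr
        _ = _ := by simp
    have hlog : Real.log (u n) ≤ K + c * n := by
      rcases Nat.eq_zero_or_pos (u n) with h0 | h0
      · rw [h0]
        simp only [Nat.cast_zero, Real.log_zero]
        positivity
      · calc Real.log (u n) ≤ Real.log ((L + 1) * Real.exp (c * (n + M + L))) :=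
              Real.log_le_log (by exact_mod_cast h0) hle
          _ = K + c * n := by
            rw [Real.log_mul (by positivity) (Real.exp_pos _).ne', Real.log_exp, hK]
            ring
    rw [div_le_iff₀ hn0', add_mul, div_mul_cancel₀ _ hn0'.ne']
    exact hlog
  have hlim : Tendsto (fun n : ℕ => ((K / n + c : ℝ) : EReal)) atTop (𝓝 (c : EReal)) := by
    have h1 : Tendsto (fun n : ℕ => K / n + c) atTop (𝓝 c) := by
      simpa using (tendsto_const_div_atTop_nhds_zero_nat K).add_const c
    exact (continuous_coe_real_ereal.tendsto c).comp h1
  rw [← hlim.limsup_eq]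
  refine limsup_le_limsup ?_
  filter_upwards [hu] with n hn
  exact_mod_cast hn

theorem shiftMap_iterate_apply {A : Type*} (n : ℕ) (x : ℤ → A) (i : ℤ) :
    shiftMap^[n] x i = x (i + n) := by
  induction n generalizing x i with
  | zero => simp
  | succ n ih =>
    rw [Function.iterate_succ_apply, ih]
    simp only [shiftMap]
    congr 1
    push_cast
    ring

theorem IsOneStepSFT.isClosed {A : Type*} [TopologicalSpace A] [DiscreteTopology A]
    {X : Set (ℤ → A)} (hX : IsOneStepSFT X) : IsClosed X := by
  obtain ⟨R, rfl⟩ := hX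
  simp only [Set.ofPred_forall]
  exact isClosed_iInter fun i => (isClosed_discrete R).preimage
    (f := fun x : ℤ → A => (x i, x (i + 1))) (by fun_prop)

theorem IsOneStepSFT.iterate_mem {A : Type*} {X : Set (ℤ → A)} (hX : IsOneStepSFT X) (n : ℕ)
    {x : ℤ → A} (hx : x ∈ X) : shiftMap^[n] x ∈ X := by
  obtain ⟨R, rfl⟩ := hX
  intro i
  rw [shiftMap_iterate_apply, shiftMap_iterate_apply, add_right_comm]
  exact hx _

/-- On a closed subset of a full shift, a continuous map is determined up to a small error by a
finite central window of coordinates. -/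
theorem exists_window {A Ω : Type*} [TopologicalSpace A] [DiscreteTopology A] [Finite A]
    [PseudoMetricSpace Ω] {X : Set (ℤ → A)} (hX : IsClosed X) {π : (ℤ → A) → Ω}
    (hπ : ContinuousOn π X) {η : ℝ} (hη : 0 < η) :
    ∃ m : ℕ, ∀ x ∈ X, ∀ y ∈ X, (∀ i : ℤ, -m ≤ i → i ≤ m → x i = y i) →
      dist (π x) (π y) < η := by
  have hclosed : IsClosed ((X ×ˢ X) ∩ {q : (ℤ → A) × (ℤ → A) | η ≤ dist (π q.1) (π q.2)}) := by
    have hc : ContinuousOn (fun q : (ℤ → A) × (ℤ → A) => dist (π q.1) (π q.2)) (X ×ˢ X) :=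
      continuous_dist.comp_continuousOn
        ((hπ.comp continuousOn_fst fun _ hq => (Set.mem_prod.1 hq).1).prodMk
          (hπ.comp continuousOn_snd fun _ hq => (Set.mem_prod.1 hq).2))
    exact hc.preimage_isClosed_of_isClosed (hX.prod hX) isClosed_Ici
  let D : ℕ → Set ((ℤ → A) × (ℤ → A)) := fun m => {q | ∀ i : ℤ, -m ≤ i → i ≤ m → q.1 i = q.2 i}
  have hDc : ∀ m, IsClosed (D m) := by
    intro m
    simp only [D, Set.ofPred_forall]
    refine isClosed_iInter fun i => isClosed_iInter fun _ => isClosed_iInter fun _ =>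
      isClosed_eq (by fun_prop) (by fun_prop)
  have hDanti : Antitone D := fun a b hab q hq i h1 h2 => hq i (by omega) (by omega)
  obtain ⟨m, hm⟩ := hclosed.isCompact.elim_directed_family_closed D hDc (by
      rw [Set.eq_empty_iff_forall_notMem]
      rintro ⟨x, y⟩ ⟨⟨-, hd⟩, hD⟩
      have hxy : x = y := by
        funext i
        exact Set.mem_iInter.1 hD i.natAbs i (by omega) (by omega)
      subst hxy
      simp only [Set.mem_ofPred_eq, dist_self] at hd
      exact hd.not_gt hη) hDanti.directed_ge
  refine ⟨m, fun x hx y hy h => ?_⟩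
  by_contra! hd
  have : (x, y) ∈ (∅ : Set ((ℤ → A) × (ℤ → A))) := hm ▸ ⟨⟨⟨hx, hy⟩, hd⟩, h⟩
  exact this

theorem map_iterate_shiftMap {A Ω : Type*} {X : Set (ℤ → A)} (hX : IsOneStepSFT X)
    {π : (ℤ → A) → Ω} {f : Ω → Ω} (hsemi : ∀ x ∈ X, π (shiftMap x) = f (π x)) (n : ℕ)
    {x : ℤ → A} (hx : x ∈ X) : π (shiftMap^[n] x) = f^[n] (π x) := by
  induction n with
  | zero => rfl
  | succ n ih =>
    rw [Function.iterate_succ_apply', Function.iterate_succ_apply',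
      hsemi _ (hX.iterate_mem n hx), ih]

theorem bddAbove_card_isSeparatedSet {A Ω : Type*} [TopologicalSpace A] [DiscreteTopology A]
    [Finite A] [PseudoMetricSpace Ω] {X : Set (ℤ → A)} (hX : IsOneStepSFT X) {π : (ℤ → A) → Ω}
    (hπ : ContinuousOn π X) (hsurj : π '' X = Set.univ) {f : Ω → Ω}
    (hsemi : ∀ x ∈ X, π (shiftMap x) = f (π x)) (n : ℕ) {ε : ℝ} (hε : 0 < ε) :
    BddAbove {k : ℕ | ∃ E : Finset Ω, IsSeparatedSet f n ε ↑E ∧ E.card = k} := by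
  obtain ⟨m, hm⟩ := exists_window hX.isClosed hπ hε
  have hpre : ∀ z : Ω, ∃ x ∈ X, π x = z := fun z => by
    have : z ∈ π '' X := hsurj ▸ Set.mem_univ z
    exact this
  choose g hgX hg using hpre
  refine ⟨Nat.card (Fin (n + 2 * m + 1) → A), ?_⟩
  rintro _ ⟨E, hE, rfl⟩
  have hinj : Function.Injective
      (fun (z : E) (j : Fin (n + 2 * m + 1)) => g z ((j : ℕ) - m : ℤ)) := by
    intro z w hzw
    by_contra hne
    obtain ⟨i, hi, hd⟩ := hE z z.2 w w.2 (fun h => hne (Subtype.ext h))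
    rw [← hg z, ← hg w, ← map_iterate_shiftMap hX hsemi i (hgX _),
      ← map_iterate_shiftMap hX hsemi i (hgX _)] at hd
    refine hd.not_gt (hm _ (hX.iterate_mem _ (hgX _)) _ (hX.iterate_mem _ (hgX _)) fun j h1 h2 => ?_)
    rw [shiftMap_iterate_apply, shiftMap_iterate_apply]
    have h3 := congrFun hzw ⟨(j + i + m).toNat, by omega⟩
    have h4 : (((j + i + m).toNat : ℕ) - m : ℤ) = j + i := by omega
    simpa only [h4] using h3
  simpa using Nat.card_le_card_of_injective _ hinj

theorem isSeparatedSet_periodicPts {Ω : Type*} [MetricSpace Ω] {f : Ω ≃ₜ Ω} {ε : ℝ}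
    (hexp : ∀ x y : Ω, x ≠ y → ∃ n : ℤ, ε < dist ((f.toEquiv ^ n) x) ((f.toEquiv ^ n) y))
    {n : ℕ} (hn : 0 < n) : IsSeparatedSet f n ε {x : Ω | (⇑f)^[n] x = x} := by
  have key : ∀ x : Ω, (⇑f)^[n] x = x → ∀ k : ℤ,
      (f.toEquiv ^ k) x = (⇑f)^[(k % n).toNat] x := by
    intro x hx k
    have hit : ∀ j : ℕ, (⇑f)^[j] x = (f.toEquiv ^ j) x := fun j => by
      rw [← Equiv.Perm.iterate_eq_pow]
      rfl
    rw [hit] at hx ⊢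
    have hk : k = ((k % n).toNat : ℤ) + n * (k / n) := by
      rw [Int.toNat_of_nonneg (Int.emod_nonneg _ (by omega)), Int.emod_add_mul_ediv]
    conv_lhs => rw [hk, zpow_add, zpow_mul, Equiv.Perm.mul_apply, zpow_natCast, zpow_natCast,
      Equiv.Perm.zpow_apply_eq_self_of_apply_eq_self hx]
  intro x hx y hy hxy
  obtain ⟨k, hk⟩ := hexp x y hxy
  rw [key x hx, key y hy] at hk
  have h1 := Int.emod_lt_of_pos k (show (0 : ℤ) < n by omega)
  have h2 := Int.emod_nonneg k (show (n : ℤ) ≠ 0 by omega)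
  exact ⟨_, by omega, hk⟩

/-- A transitive homeomorphism of a compact metric space has a point whose forward orbit visits
every nonempty open set at arbitrarily late times. -/
theorem TopTrans.exists_dense_orbit {Ω : Type*} [MetricSpace Ω] [CompactSpace Ω] [Nonempty Ω]
    {f : Ω ≃ₜ Ω} (h : TopTrans f) :
    ∃ z : Ω, ∀ V : Set Ω, IsOpen V → V.Nonempty → ∀ N : ℕ, ∃ k, N ≤ k ∧ (⇑f)^[k] z ∈ V := by
  obtain ⟨b, hbc, hb0, hb⟩ := TopologicalSpace.exists_countable_basis Ω
  have : Countable b := hbc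
  let G : b × ℕ → Set Ω := fun q => ⋃ k ≥ q.2, (⇑f)^[k] ⁻¹' q.1.1
  have hGo : ∀ q, IsOpen (G q) := fun q =>
    isOpen_biUnion fun k _ => (hb.isOpen q.1.2).preimage (f.continuous.iterate k)
  have hGd : ∀ q, Dense (G q) := by
    rintro ⟨⟨B, hB⟩, N⟩
    rw [dense_iff_inter_open]
    intro U hU hUne
    have hBne : B.Nonempty := Set.nonempty_iff_ne_empty.2 fun h => hb0 (h ▸ hB)
    obtain ⟨n, -, w, hwU, hw⟩ := h U ((⇑f)^[N] ⁻¹' B) hU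
      ((hb.isOpen hB).preimage (f.continuous.iterate N)) hUne
      (hBne.preimage (f.surjective.iterate N))
    refine ⟨w, hwU, Set.mem_iUnion₂.2 ⟨N + n, by simp, ?_⟩⟩
    simpa only [Set.mem_preimage, Function.iterate_add_apply] using hw
  obtain ⟨z, hz⟩ := (dense_iInter_of_isOpen hGo hGd).nonempty
  refine ⟨z, fun V hV ⟨v, hv⟩ N => ?_⟩
  obtain ⟨B, hB, -, hBV⟩ := hb.exists_subset_of_mem_open hv hV
  obtain ⟨k, hk, hkB⟩ := Set.mem_iUnion₂.1 (Set.mem_iInter.1 hz (⟨B, hB⟩, N))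
  exact ⟨k, hk, hBV hkB⟩

/-- `HasPath R l s t`: the relation `R` admits a path with `l` steps from `s` to `t`. -/
def HasPath {A : Type*} (R : Set (A × A)) (l : ℕ) (s t : A) : Prop :=
  ∃ q : ℕ → A, q 0 = s ∧ q l = t ∧ ∀ i < l, (q i, q (i + 1)) ∈ R

theorem exists_hasPath_bound {A : Type*} [Finite A] (R : Set (A × A)) :
    ∃ L : ℕ, ∀ s t : A, (∃ l, HasPath R l s t) → ∃ l ≤ L, HasPath R l s t := by
  classical
  cases nonempty_fintype A
  let len : A × A → ℕ := fun q => if h : ∃ l, HasPath R l q.1 q.2 then Nat.find h else 0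
  refine ⟨Finset.univ.sup len, fun s t h => ⟨len (s, t), Finset.le_sup (Finset.mem_univ _), ?_⟩⟩
  simp only [len, dif_pos h]
  exact Nat.find_spec h

/-- A path that closes up unrolls to a periodic point of the shift of finite type. -/
theorem exists_periodic_of_closed_path {A : Type*} {R : Set (A × A)} {v : ℕ → A} {P : ℕ}
    (hP : 0 < P) (hclose : v P = v 0) (hv : ∀ i < P, (v i, v (i + 1)) ∈ R) :
    ∃ y : ℤ → A, (∀ i, (y i, y (i + 1)) ∈ R) ∧ shiftMap^[P] y = y ∧
      ∀ i < P, y i = v i := by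
  refine ⟨fun i => v (i % P).toNat, fun i => ?_, ?_, fun i hi => ?_⟩
  · have h1 := Int.emod_lt_of_pos i (show (0 : ℤ) < P by omega)
    have h2 := Int.emod_nonneg i (show (P : ℤ) ≠ 0 by omega)
    have h3 := hv (i % P).toNat (by omega)
    have h4 : v ((i + 1) % P).toNat = v ((i % P).toNat + 1) := by
      rw [← Int.emod_add_emod]
      rcases eq_or_ne (i % P + 1) (P : ℤ) with h | h
      · rw [h, Int.emod_self, show (i % P).toNat + 1 = P by omega, hclose]
        rfl
      · rw [Int.emod_eq_of_lt (by omega) (by omega)]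
        congr 1
        omega
    simpa only [h4] using h3
  · funext i
    rw [shiftMap_iterate_apply]
    simp
  · simp only
    rw [Int.emod_eq_of_lt (by omega) (by omega)]
    simp

/-- The symbols of a sequence over a finite alphabet eventually all recur infinitely often. -/
theorem exists_forall_frequently_eq {A : Type*} [Finite A] (x : ℤ → A) :
    ∃ N : ℕ, ∀ i ≥ N, ∃ᶠ j : ℕ in atTop, x j = x i := by
  have h : ∀ᶠ i : ℕ in atTop, ∀ a : A, (¬ ∃ᶠ j : ℕ in atTop, x j = a) → x i ≠ a := by
    rw [eventually_all]
    intro a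
    by_cases ha : ∃ᶠ j : ℕ in atTop, x j = a
    · exact Eventually.of_forall fun i h => absurd ha h
    · filter_upwards [not_frequently.1 ha] with i hi _ using hi
  obtain ⟨N, hN⟩ := eventually_atTop.1 h
  exact ⟨N, fun i hi => by_contra fun hc => hN i hi _ hc rfl⟩

/-- In a transitive factor of a shift of finite type, every orbit segment is shadowed by a periodic
orbit whose period exceeds the length of the segment by a bounded amount. -/
theorem exists_periodic_shadowing {A Ω : Type*} [TopologicalSpace A] [DiscreteTopology A]
    [Finite A] [MetricSpace Ω] [CompactSpace Ω] [Nonempty Ω] {X : Set (ℤ → A)}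
    (hX : IsOneStepSFT X) {π : (ℤ → A) → Ω} (hπ : ContinuousOn π X) (hsurj : π '' X = Set.univ)
    {f : Ω ≃ₜ Ω} (hsemi : ∀ x ∈ X, π (shiftMap x) = f (π x)) (htrans : TopTrans f)
    {η : ℝ} (hη : 0 < η) :
    ∃ M L : ℕ, 0 < M ∧ ∀ (n : ℕ) (z : Ω), ∃ l ≤ L, ∃ p : Ω, (⇑f)^[n + M + l] p = p ∧
      ∀ i < n, dist ((⇑f)^[i] p) ((⇑f)^[i] z) < η := by
  have hX' := hX
  obtain ⟨R, hR⟩ := hX'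
  have hXR : ∀ x, x ∈ X ↔ ∀ i : ℤ, (x i, x (i + 1)) ∈ R := fun x => by rw [hR]; rfl
  obtain ⟨m, hm⟩ := exists_window hX.isClosed hπ (half_pos hη)
  obtain ⟨L, hL⟩ := exists_hasPath_bound R
  obtain ⟨z₀, hz₀⟩ := htrans.exists_dense_orbit
  obtain ⟨x, hxX, rfl⟩ : z₀ ∈ π '' X := hsurj ▸ Set.mem_univ z₀
  obtain ⟨N, hN⟩ := exists_forall_frequently_eq x
  refine ⟨2 * m + 1, L, by omega, fun n z => ?_⟩
  obtain ⟨k, hk, hkV⟩ := hz₀ (⋂ i ∈ Finset.range n, {w | dist ((⇑f)^[i] w) ((⇑f)^[i] z) < η / 2})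
    (isOpen_biInter_finset fun i _ => isOpen_lt
      ((f.continuous.iterate i).dist continuous_const) continuous_const)
    ⟨z, by simp [half_pos hη]⟩ (N + m)
  simp only [Finset.mem_range, Set.mem_iInter, Set.mem_ofPred_eq] at hkV
  obtain ⟨k, rfl⟩ := Nat.exists_eq_add_of_le' (show m ≤ k by omega)
  set W := n + (2 * m + 1) with hW
  obtain ⟨j, hj, hjx⟩ := frequently_atTop.1 (hN k (by omega)) (k + W)
  have hpath : ∃ l, HasPath R l (x (k + W : ℕ)) (x k) := by
    refine ⟨j - (k + W), fun i => x (k + W + i : ℕ), rfl, ?_, fun i _ => ?_⟩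
    · simp only
      rw [Nat.add_sub_cancel' hj, hjx]
    · have := (hXR x).1 hxX (k + W + i : ℕ)
      exact_mod_cast this
  obtain ⟨l, hl, q, hq0, hql, hq⟩ := hL _ _ hpath
  let v : ℕ → A := fun i => if i ≤ W then x (k + i : ℕ) else q (i - W)
  have hvW : ∀ i, v (W + i) = q i := by
    intro i
    rcases Nat.eq_zero_or_pos i with rfl | hi
    · simp [v, hq0]
    · simp only [v, if_neg (show ¬ W + i ≤ W by omega), Nat.add_sub_cancel_left]
  have hvx : ∀ i ≤ W, v i = x (k + i : ℕ) := fun i hi => if_pos hi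
  obtain ⟨y, hyR, hyP, hyv⟩ := exists_periodic_of_closed_path (R := R) (v := v) (P := W + l)
    (by omega) (by rw [hvW, hql, hvx 0 (Nat.zero_le _)]; rfl) (by
      intro i hi
      rcases lt_or_ge i W with h | h
      · rw [hvx i h.le, hvx (i + 1) h]
        have := (hXR x).1 hxX (k + i : ℕ)
        exact_mod_cast this
      · obtain ⟨i, rfl⟩ := Nat.exists_eq_add_of_le h
        rw [show W + i + 1 = W + (i + 1) from rfl, hvW, hvW]
        exact hq i (by omega))
  have hyX : y ∈ X := (hXR y).2 hyR
  refine ⟨l, hl, π (shiftMap^[m] y), ?_, fun i hi => ?_⟩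
  · rw [← map_iterate_shiftMap hX hsemi _ (hX.iterate_mem _ hyX), ← Function.iterate_add_apply,
      add_comm, Function.iterate_add_apply, hyP]
  · have h1 : dist ((⇑f)^[i] (π (shiftMap^[m] y))) ((⇑f)^[i] ((⇑f)^[k + m] (π x))) < η / 2 := by
      rw [← map_iterate_shiftMap hX hsemi _ (hX.iterate_mem _ hyX),
        ← map_iterate_shiftMap hX hsemi _ hxX,
        ← map_iterate_shiftMap hX hsemi _ (hX.iterate_mem _ hxX)]
      refine hm _ (hX.iterate_mem _ (hX.iterate_mem _ hyX)) _
        (hX.iterate_mem _ (hX.iterate_mem _ hxX)) fun t ht1 ht2 => ?_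
      simp only [shiftMap_iterate_apply]
      obtain ⟨r, hr⟩ := Int.eq_ofNat_of_zero_le (show 0 ≤ t + i + m by omega)
      rw [hr, hyv r (by omega), hvx r (by omega)]
      congr 1
      push_cast
      omega
    calc _ ≤ _ := dist_triangle _ ((⇑f)^[i] ((⇑f)^[k + m] (π x))) _
      _ < η / 2 + η / 2 := add_lt_add h1 (hkV i hi)
      _ = η := add_halves η

theorem card_le_sum_card_periodicPts {Ω : Type*} [PseudoMetricSpace Ω] {f : Ω → Ω} {ε : ℝ}
    {n M L : ℕ} (hfin : ∀ l, {x : Ω | f^[n + M + l] x = x}.Finite)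
    (hshadow : ∀ z : Ω, ∃ l ≤ L, ∃ p : Ω, f^[n + M + l] p = p ∧
      ∀ i < n, dist (f^[i] p) (f^[i] z) < ε / 2)
    {E : Finset Ω} (hE : IsSeparatedSet f n ε ↑E) :
    E.card ≤ ∑ l ∈ Finset.range (L + 1), Nat.card {x : Ω | f^[n + M + l] x = x} := by
  choose l hl p hp hd using hshadow
  have hcard : ∀ l, Nat.card {x : Ω | f^[n + M + l] x = x} = (hfin l).toFinset.card := fun l => by
    rw [Nat.card_coe_set_eq, Set.ncard_eq_toFinset_card _ (hfin l)]
  simp only [hcard]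
  rw [← Finset.card_sigma]
  refine Finset.card_le_card_of_injOn (fun z => ⟨l z, p z⟩) ?_ ?_
  · intro z _
    simp only [Finset.coe_sigma, Set.mem_sigma_iff, Finset.mem_coe, Finset.mem_range,
      Set.Finite.mem_toFinset, Set.mem_ofPred_eq]
    exact ⟨Nat.lt_succ_of_le (hl z), hp z⟩
  · intro z hz w hw hzw
    have hpeq : p z = p w := by
      simp only [Sigma.mk.injEq, heq_eq_eq] at hzw
      exact hzw.2
    by_contra hne
    obtain ⟨i, hi, hlt⟩ := hE z hz w hw hne
    have h1 := hd z i hi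
    have h2 := hd w i hi
    rw [hpeq] at h1
    have h3 := dist_triangle_left (f^[i] z) (f^[i] w) (f^[i] (p w))
    linarith

/-- For a topologically transitive finitely presented system, the sets of `n`-periodic
points are finite and the topological entropy equals the exponential growth rate of the
periodic-point counts. -/
theorem entropy_eq_growth_of_periodic_points_of_transitive_FP
    {Ω : Type*} [MetricSpace Ω] [CompactSpace Ω] [Nonempty Ω]
    (f : Ω ≃ₜ Ω) (hFP : IsFPSystem f) (htrans : TopTrans (⇑f)) :
    (∀ n : ℕ, 0 < n → {x : Ω | (⇑f)^[n] x = x}.Finite) ∧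
    topEntropy (⇑f) =
      Filter.atTop.limsup
        (fun n : ℕ =>
          ((Real.log (Nat.card {x : Ω | (⇑f)^[n] x = x}) / n : ℝ) : EReal)) := by
  obtain ⟨⟨ε, hε, hexp⟩, a, X, π, hX, hπ, hsurj, hsemi⟩ := hFP
  have hbdd : ∀ (n : ℕ) {δ : ℝ}, 0 < δ → BddAbove
      {k : ℕ | ∃ E : Finset Ω, IsSeparatedSet f n δ ↑E ∧ E.card = k} :=
    fun n δ hδ => bddAbove_card_isSeparatedSet hX hπ hsurj hsemi n hδ
  have hsub : ∀ n : ℕ, 0 < n → ∀ E : Finset Ω, (E : Set Ω) ⊆ {x : Ω | (⇑f)^[n] x = x} →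
      E.card ≤ sepNum f n ε := fun n hn E hE =>
    le_csSup (hbdd n hε) ⟨E, fun x hx y hy =>
      isSeparatedSet_periodicPts hexp hn x (hE hx) y (hE hy), rfl⟩
  have hfin : ∀ n : ℕ, 0 < n → {x : Ω | (⇑f)^[n] x = x}.Finite := by
    intro n hn
    by_contra hinf
    obtain ⟨E, hE, hcard⟩ := Set.Infinite.exists_subset_card_eq hinf (sepNum f n ε + 1)
    have := hsub n hn E hE
    omega
  refine ⟨hfin, le_antisymm (iSup₂_le fun δ hδ => ?_) (le_iSup₂_of_le ε hε ?_)⟩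
  · obtain ⟨M, L, hM, hML⟩ :=
      exists_periodic_shadowing hX hπ hsurj hsemi htrans (half_pos hδ)
    refine limsup_log_div_le_of_le_sum
      (p := fun n => Nat.card {x : Ω | (⇑f)^[n] x = x}) (M := M) (L := L) fun n => ?_
    refine csSup_le' ?_
    rintro _ ⟨E, hE, rfl⟩
    exact card_le_sum_card_periodicPts (fun l => hfin _ (by omega)) (hML n) hE
  · refine limsup_le_limsup ?_
    filter_upwards [eventually_gt_atTop 0] with n hn
    have hle : Nat.card {x : Ω | (⇑f)^[n] x = x} ≤ sepNum f n ε := by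
      rw [Nat.card_coe_set_eq, Set.ncard_eq_toFinset_card _ (hfin n hn)]
      exact hsub n hn _ (by simp)
    rcases Nat.eq_zero_or_pos (Nat.card {x : Ω | (⇑f)^[n] x = x}) with h0 | h0
    · rw [h0]
      simp only [Nat.cast_zero, Real.log_zero, zero_div, EReal.coe_zero]
      exact_mod_cast div_nonneg (Real.log_natCast_nonneg _) (Nat.cast_nonneg _)
    · have h1 : Real.log (Nat.card {x : Ω | (⇑f)^[n] x = x}) ≤ Real.log (sepNum f n ε) :=
        Real.log_le_log (by exact_mod_cast h0) (by exact_mod_cast hle)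
      exact EReal.coe_le_coe_iff.2 (div_le_div_of_nonneg_right h1 (Nat.cast_nonneg _))
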